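/- Let p be a prime and let G be a non-trivial finite p-group of order pⁿ. Then |Aut_c(G)| ≤ p^{(n²−4)/4} if n is even, and |Aut_c(G)| ≤ p^{(n²−1)/4} if n is odd. -/

import Mathlib

/-- The subgroup of `MulAut G` consisting of class preserving automorphisms. -/
def classPreservingAuts (G : Type*) [Group G] : Subgroup (MulAut G) where
  carrier := {α | ∀ x : G, IsConj x (α x)}
  one_mem' := fun x => by simpa using IsConj.refl x
  mul_mem' := fun {a b} ha hb x => (hb x).trans (ha (b x))
  inv_mem' := fun {a} ha x => by
    have h := (ha (a⁻¹ x)).symm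
    simpa using h


section ClassPreservingBound

open scoped commutatorElement

variable {p : ℕ} {G : Type*} [Group G]

lemma card_conj_orbit_eq_index_centralizer [Finite G] (g : G) :
    Nat.card {y : G // IsConj g y} = (Subgroup.centralizer {g}).index := by
  have h := MulAction.index_stabilizer (ConjAct G) g
  rw [ConjAct.stabilizer_eq_centralizer] at h
  rw [← Subgroup.index_comap_of_surjective (Subgroup.centralizer {g})
    (f := (ConjAct.ofConjAct : ConjAct G ≃* G).toMonoidHom) ConjAct.ofConjAct.surjective]
  refine Eq.trans ?_ h.symm
  rw [← Nat.card_coe_set_eq]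
  refine Nat.card_congr (Equiv.subtypeEquivRight fun y => ?_)
  rw [← ConjAct.mem_orbit_conjAct, MulAction.mem_orbit_symm]

lemma inv_mul_mem_commutator_of_isConj {x y : G} (h : IsConj x y) :
    x⁻¹ * y ∈ commutator G := by
  obtain ⟨c, rfl⟩ := isConj_iff.1 h
  have := Subgroup.commutator_mem_commutator (Subgroup.mem_top x⁻¹) (Subgroup.mem_top c)
  simpa [commutatorElement_def, commutator_def, mul_assoc] using this

/-- A conjugacy class is at most as large as the commutator subgroup. -/
lemma index_centralizer_le_card_commutator [Finite G] (g : G) :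
    (Subgroup.centralizer {g}).index ≤ Nat.card (commutator G) := by
  rw [← card_conj_orbit_eq_index_centralizer]
  refine Nat.card_le_card_of_injective
    (fun y => (⟨g⁻¹ * y.1, inv_mul_mem_commutator_of_isConj y.2⟩ : commutator G)) ?_
  intro a b hab
  simpa [Subtype.ext_iff] using hab

lemma eq_top_of_sup_commutator_eq_top [Finite G] [Group.IsNilpotent G] {H : Subgroup G}
    (h : H ⊔ commutator G = ⊤) : H = ⊤ := by
  by_contra hne
  obtain ⟨M, hM, hHM⟩ := (eq_top_or_exists_le_coatom H).resolve_left hne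
  have hn : M.Normal := Subgroup.NormalizerCondition.normal_of_coatom M
    Group.normalizerCondition_of_isNilpotent hM
  have : Nontrivial (G ⧸ M) := QuotientGroup.nontrivial_iff.2 hM.1
  have hlt := Group.IsSolvable.commutator_lt_top_of_nontrivial (G ⧸ M)
  refine hlt.ne ?_
  have hs := QuotientGroup.mk'_surjective M
  rw [commutator_def, ← Subgroup.map_top_of_surjective _ hs, ← Subgroup.map_commutator,
    ← commutator_def, ← h, Subgroup.map_sup]
  refine (sup_eq_right.2 ?_).symm
  rw [(Subgroup.map_eq_bot_iff _).2 (by simpa using hHM)]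
  exact bot_le

lemma eq_bot_of_commutator_top_eq_self [Group.IsNilpotent G] {H : Subgroup G}
    (h : ⁅H, (⊤ : Subgroup G)⁆ = H) : H = ⊥ := by
  obtain ⟨n, hn⟩ := Subgroup.nilpotent_iff_lowerCentralSeries.1 ‹Group.IsNilpotent G›
  rw [eq_bot_iff, ← hn]
  clear hn
  induction n with
  | zero => simp
  | succ n ih =>
    rw [Subgroup.lowerCentralSeries_succ, ← h]
    exact Subgroup.commutator_mono ih le_rfl

lemma exists_index_dvd_pow_of_lt (hp : p.Prime) {L L' : Subgroup G} (hlt : L < L') {k : ℕ}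
    (hL : L.index ∣ p ^ k) : ∃ j, k = j + 1 ∧ L'.index ∣ p ^ j := by
  have hr : L.relIndex L' ≠ 1 := fun h => hlt.not_ge (Subgroup.relIndex_eq_one.1 h)
  rw [← Subgroup.relIndex_mul_index hlt.le] at hL
  obtain ⟨i, -, hi⟩ := (Nat.dvd_prime_pow hp).1 ((dvd_mul_right _ _).trans hL)
  obtain ⟨l, -, hl⟩ := (Nat.dvd_prime_pow hp).1 ((dvd_mul_left _ _).trans hL)
  rw [hi, hl, ← pow_add, Nat.pow_dvd_pow_iff_le_right hp.one_lt] at hL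
  have : i ≠ 0 := by rintro rfl; simp [hi] at hr
  exact ⟨k - 1, by omega, hl ▸ pow_dvd_pow p (by omega)⟩

lemma card_le_card_mul_card_inf_stabilizer [Finite G] (B : Subgroup (MulAut G)) (g : G)
    (T : Set G) (hT : ∀ α ∈ B, α g ∈ T) :
    Nat.card B ≤ Nat.card T *
      Nat.card (B ⊓ MulAction.stabilizer (MulAut G) g : Subgroup (MulAut G)) := by
  have h1 := (MulAction.stabilizer B g).card_mul_index
  have h2 : Nat.card (MulAction.stabilizer B g) =
      Nat.card (B ⊓ MulAction.stabilizer (MulAut G) g : Subgroup (MulAut G)) := by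
    refine Nat.card_congr ⟨fun a => ⟨a.1.1, a.1.2, a.2⟩, fun a => ⟨⟨a.1, a.2.1⟩, a.2.2⟩, ?_, ?_⟩
    · exact fun _ => rfl
    · exact fun _ => rfl
  rw [MulAction.index_stabilizer] at h1
  rw [← h1, h2, mul_comm, Nat.card_coe_set_eq]
  refine Nat.mul_le_mul_right _ (Set.ncard_le_ncard ?_ (Set.toFinite _))
  rintro _ ⟨a, rfl⟩
  exact hT a.1 a.2

lemma card_le_card_pow [Finite G] (hp : p.Prime) {N : Subgroup G} (k : ℕ) :
    ∀ (B : Subgroup (MulAut G)) (H : Subgroup G),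
      (∀ α ∈ B, ∀ h ∈ H, α h = h) → (∀ α ∈ B, ∀ g, g⁻¹ * α g ∈ N) →
      (∀ K, H ≤ K → K ⊔ N = ⊤ → K = ⊤) → (H ⊔ N).index ∣ p ^ k →
      Nat.card B ≤ Nat.card N ^ k := by
  induction k with
  | zero =>
    intro B H hB _ hK hi
    have htop : H = ⊤ := hK H le_rfl (by simpa using hi)
    have : B = ⊥ := by
      rw [Subgroup.eq_bot_iff_forall]
      intro α hα
      ext g
      exact hB α hα g (htop ▸ Subgroup.mem_top g)
    simp [this]
  | succ k ih =>
    intro B H hB hN hK hi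
    by_cases htop : H ⊔ N = ⊤
    · have hH := hK H le_rfl htop
      have : B = ⊥ := by
        rw [Subgroup.eq_bot_iff_forall]
        intro α hα
        ext g
        exact hB α hα g (hH ▸ Subgroup.mem_top g)
      rw [this]
      simpa using Nat.one_le_pow _ _ Nat.card_pos
    obtain ⟨z, -, hz⟩ := SetLike.exists_of_lt (lt_top_iff_ne_top.2 htop)
    have hlt : H ⊔ N < (H ⊔ Subgroup.zpowers z) ⊔ N := by
      refine lt_of_le_of_ne (sup_le_sup_right le_sup_left _) fun h => hz ?_
      rw [h]
      exact Subgroup.mem_sup_left (Subgroup.mem_sup_right (Subgroup.mem_zpowers z))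
    obtain ⟨j, hj, hd⟩ := exists_index_dvd_pow_of_lt hp hlt hi
    obtain rfl : k = j := by omega
    have h1 := ih (B ⊓ MulAction.stabilizer (MulAut G) z) (H ⊔ Subgroup.zpowers z) ?_
      (fun α hα => hN α hα.1) (fun K hHK => hK K (le_sup_left.trans hHK)) hd
    · have h2 := card_le_card_mul_card_inf_stabilizer B z ((fun c => z * c) '' (N : Set G))
        (fun α hα => ⟨_, hN α hα z, by simp⟩)
      rw [Nat.card_image_of_injective (mul_right_injective z)] at h2
      rw [pow_succ']
      exact h2.trans (Nat.mul_le_mul_left _ h1)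
    · intro α hα
      suffices H ⊔ Subgroup.zpowers z ≤ (α : G ≃* G).toMonoidHom.eqLocus (MonoidHom.id G) from
        fun h hh => this hh
      rw [sup_le_iff, Subgroup.zpowers_le]
      exact ⟨fun h hh => hB α hα.1 h hh, hα.2⟩

lemma ker_conjNormal_le_centralizer {M : Subgroup G} [M.Normal] :
    (MulAut.conjNormal : G →* MulAut M).ker ≤ Subgroup.centralizer (M : Set G) := by
  intro g hg
  rw [Subgroup.mem_centralizer_iff]
  intro h hh
  have h1 := congrArg (fun f : MulAut M => (f ⟨h, hh⟩ : G)) (MonoidHom.mem_ker.1 hg)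
  simp only [MulAut.conjNormal_apply, MulAut.one_apply] at h1
  rw [mul_inv_eq_iff_eq_mul] at h1
  exact h1.symm

lemma index_centralizer_le_pow [Finite G] (hp : p.Prime) {M N : Subgroup G} [M.Normal]
    (hNM : N ≤ M) (hMN : ⁅M, (⊤ : Subgroup G)⁆ ≤ N) (hN : N ≤ Subgroup.center G) {k : ℕ}
    (hk : N.relIndex M ∣ p ^ k) :
    (Subgroup.centralizer (M : Set G)).index ≤ Nat.card N ^ k := by
  have h1 := card_le_card_pow hp (N := N.subgroupOf M) k
    (MulAut.conjNormal : G →* MulAut M).range (N.subgroupOf M) ?_ ?_ ?_ ?_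
  · rw [← Subgroup.index_ker, Nat.card_congr (Subgroup.subgroupOfEquivOfLe hNM).toEquiv] at h1
    exact (Nat.le_of_dvd (Nat.pos_of_ne_zero Subgroup.index_ne_zero_of_finite)
      (Subgroup.index_dvd_of_le ker_conjNormal_le_centralizer)).trans h1
  · rintro _ ⟨g, rfl⟩ h hh
    ext
    rw [MulAut.conjNormal_apply, mul_inv_eq_iff_eq_mul]
    exact Subgroup.mem_center_iff.1 (hN hh) g
  · rintro _ ⟨g, rfl⟩ h
    refine hMN ?_
    have := Subgroup.commutator_mem_commutator (M.inv_mem h.2) (Subgroup.mem_top g)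
    simpa [commutatorElement_def, mul_assoc] using this
  · intro K hK h
    rwa [sup_eq_left.2 hK] at h
  · rwa [sup_idem]

lemma mem_comap_centralizer_iff {K : Subgroup G} [K.Normal] {x y : G} :
    y ∈ (Subgroup.centralizer {QuotientGroup.mk' K x}).comap (QuotientGroup.mk' K) ↔
      ⁅x, y⁆ ∈ K := by
  rw [Subgroup.mem_comap, Subgroup.mem_centralizer_singleton_iff, eq_comm,
    ← commutatorElement_eq_one_iff_mul_comm, ← map_commutatorElement, ← MonoidHom.mem_ker,
    QuotientGroup.ker_mk']

lemma card_map_mk_mul_card [Finite G] {K M : Subgroup G} [K.Normal] (h : K ≤ M) :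
    Nat.card (M.map (QuotientGroup.mk' K)) * Nat.card K = Nat.card M := by
  have h1 := Subgroup.relIndex_ker (QuotientGroup.mk' K) (K := M)
  rw [QuotientGroup.ker_mk'] at h1
  rw [← h1, mul_comm, ← Subgroup.relIndex_bot_left, ← Subgroup.relIndex_bot_left,
    Subgroup.relIndex_mul_relIndex _ _ _ bot_le h]

lemma card_le_pow_of_le_classPreservingAuts [Finite G] [Group.IsNilpotent G] (hp : p.Prime)
    {B : Subgroup (MulAut G)} {H : Subgroup G} (hB : B ≤ classPreservingAuts G)
    (hH : ∀ α ∈ B, ∀ h ∈ H, α h = h) {k : ℕ} (hk : (H ⊔ commutator G).index ∣ p ^ k) :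
    Nat.card B ≤ Nat.card (commutator G) ^ k :=
  card_le_card_pow hp k B H hH (fun _ hα g => inv_mul_mem_commutator_of_isConj (hB hα g))
    (fun _ _ hK => eq_top_of_sup_commutator_eq_top hK) hk

/-- A class preserving automorphism fixing `x` and sending `y` to `y * c`, where `⁅x, y⁆` lies in
`N`, satisfies `⁅x, c⁆ ∈ ⁅N, ⊤⁆`. -/
lemma commutator_inv_mul_mem_of_fixes {α : MulAut G} (hα : α ∈ classPreservingAuts G)
    {N : Subgroup G} [N.Normal] {x y : G} (hx : α x = x) (hxy : ⁅x, y⁆ ∈ N) :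
    ⁅x, y⁻¹ * α y⁆ ∈ ⁅N, (⊤ : Subgroup G)⁆ := by
  obtain ⟨g, hg⟩ := isConj_iff.1 (hα ⁅x, y⁆)
  have h1 := Subgroup.commutator_mem_commutator (N.inv_mem hxy) (Subgroup.mem_top g)
  have h2 : ⁅(⁅x, y⁆)⁻¹, g⁆ = y * ⁅x, y⁻¹ * α y⁆ * y⁻¹ := by
    have : ⁅(⁅x, y⁆)⁻¹, g⁆ = (⁅x, y⁆)⁻¹ * (g * ⁅x, y⁆ * g⁻¹) := by
      simp [commutatorElement_def, mul_assoc]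
    rw [this, hg, map_commutatorElement, hx]
    simp [commutatorElement_def, mul_assoc]
  rw [h2] at h1
  have := (inferInstance : (⁅N, (⊤ : Subgroup G)⁆).Normal).conj_mem _ h1 y⁻¹
  simpa [mul_assoc] using this

lemma card_classPreservingAuts_le_of_index_zpowers_sup [Finite G] [Group.IsNilpotent G]
    (hp : p.Prime) {x : G} {k : ℕ}
    (hk : (Subgroup.zpowers x ⊔ commutator G).index ∣ p ^ k) :
    Nat.card (classPreservingAuts G) ≤
      (Subgroup.centralizer {x}).index * Nat.card (commutator G) ^ k := by
  have h1 := card_le_card_mul_card_inf_stabilizer (classPreservingAuts G) x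
    {y | IsConj x y} (fun _ hα => hα x)
  rw [← card_conj_orbit_eq_index_centralizer]
  refine h1.trans (Nat.mul_le_mul_left _ ?_)
  refine card_le_pow_of_le_classPreservingAuts hp (H := Subgroup.zpowers x) inf_le_left ?_ hk
  intro α hα
  suffices Subgroup.zpowers x ≤ (α : G ≃* G).toMonoidHom.eqLocus (MonoidHom.id G) from
    fun h hh => this hh
  rw [Subgroup.zpowers_le]
  exact hα.2

lemma card_classPreservingAuts_le_of_commutator_mem [Finite G] [Group.IsNilpotent G]
    (hp : p.Prime) {N : Subgroup G} [N.Normal] {x y : G} (hxy : ⁅x, y⁆ ∈ N) {k : ℕ}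
    (hk : (Subgroup.zpowers x ⊔ commutator G ⊔ Subgroup.zpowers y).index ∣ p ^ k) :
    Nat.card (classPreservingAuts G) ≤ (Subgroup.centralizer {x}).index *
      (Nat.card (commutator G ⊓ (Subgroup.centralizer
        {QuotientGroup.mk' ⁅N, (⊤ : Subgroup G)⁆ x}).comap (QuotientGroup.mk' _) : Subgroup G) *
        Nat.card (commutator G) ^ k) := by
  have h1 := card_le_card_mul_card_inf_stabilizer (classPreservingAuts G) x
    {y | IsConj x y} (fun _ hα => hα x)
  rw [← card_conj_orbit_eq_index_centralizer]
  refine h1.trans (Nat.mul_le_mul_left _ ?_)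
  set E : Subgroup G := commutator G ⊓ (Subgroup.centralizer
    {QuotientGroup.mk' ⁅N, (⊤ : Subgroup G)⁆ x}).comap (QuotientGroup.mk' _) with hE
  have h2 := card_le_card_mul_card_inf_stabilizer
    (classPreservingAuts G ⊓ MulAction.stabilizer (MulAut G) x) y
    ((fun c => y * c) '' (E : Set G)) (fun α hα => ⟨y⁻¹ * α y,
      ⟨inv_mul_mem_commutator_of_isConj (hα.1 y), mem_comap_centralizer_iff.2
        (commutator_inv_mul_mem_of_fixes hα.1 hα.2 hxy)⟩, by simp⟩)
  rw [Nat.card_image_of_injective (mul_right_injective y)] at h2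
  refine h2.trans (Nat.mul_le_mul_left _ ?_)
  refine card_le_pow_of_le_classPreservingAuts hp
    (H := Subgroup.zpowers x ⊔ Subgroup.zpowers y) (inf_le_left.trans inf_le_left) ?_
    (by rwa [sup_right_comm])
  intro α hα
  suffices Subgroup.zpowers x ⊔ Subgroup.zpowers y ≤
      (α : G ≃* G).toMonoidHom.eqLocus (MonoidHom.id G) from fun h hh => this hh
  rw [sup_le_iff, Subgroup.zpowers_le, Subgroup.zpowers_le]
  exact ⟨hα.1.2, hα.2⟩

lemma index_comap_centralizer_mul_card_le [Finite G] {N : Subgroup G} [N.Normal]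
    (hN : N ≤ commutator G) (x : G) :
    ((Subgroup.centralizer {QuotientGroup.mk' N x}).comap (QuotientGroup.mk' N)).index *
      Nat.card N ≤ Nat.card (commutator G) := by
  rw [Subgroup.index_comap_of_surjective _ (QuotientGroup.mk'_surjective N),
    ← card_map_mk_mul_card hN]
  refine Nat.mul_le_mul_right _ ((index_centralizer_le_card_commutator _).trans_eq ?_)
  rw [commutator_def, commutator_def, Subgroup.map_commutator,
    Subgroup.map_top_of_surjective _ (QuotientGroup.mk'_surjective N)]

/-- If `G` has order `p ^ (2 * m)` and its commutator subgroup has order `p ^ m`, then the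
class preserving automorphisms cannot attain the bound `p ^ (m * m)`. -/
lemma card_classPreservingAuts_le_of_card_commutator [Finite G] (hp : p.Prime) {m : ℕ}
    (hG : Nat.card G = p ^ (2 * (m + 1))) (hγ : Nat.card (commutator G) = p ^ (m + 1)) :
    Nat.card (classPreservingAuts G) ≤ p ^ (m * m + 2 * m) := by
  have : Fact p.Prime := ⟨hp⟩
  have : Group.IsNilpotent G := (IsPGroup.of_card hG).isNilpotent
  by_contra! hbig
  have hpp : ∀ {a b : ℕ}, a ≤ b → p ^ a ≤ p ^ b := fun h => Nat.pow_le_pow_right hp.pos h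
  have hpdvd : ∀ {a : ℕ} {L : Subgroup G}, L.index ≤ p ^ a → L.index ∣ p ^ a := by
    intro a L hL
    have : L.index ∣ p ^ (2 * (m + 1)) := hG ▸ L.index_dvd_card
    obtain ⟨i, -, hi⟩ := (Nat.dvd_prime_pow hp).1 this
    rw [hi] at hL ⊢
    exact pow_dvd_pow p ((Nat.pow_le_pow_iff_right hp.one_lt).1 hL)
  have hγi : (commutator G).index = p ^ (m + 1) := by
    have := (commutator G).card_mul_index
    rw [hγ, hG, two_mul, pow_add p (m + 1) (m + 1)] at this
    exact Nat.eq_of_mul_eq_mul_left (pow_pos hp.pos _) this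
  have hX : ∀ x ∉ commutator G, (Subgroup.zpowers x ⊔ commutator G).index ∣ p ^ m := by
    intro x hx
    have hlt : commutator G < Subgroup.zpowers x ⊔ commutator G :=
      lt_of_le_of_ne le_sup_right fun h =>
        hx (h ▸ Subgroup.mem_sup_left (Subgroup.mem_zpowers x))
    obtain ⟨j, hj, hd⟩ := exists_index_dvd_pow_of_lt hp hlt hγi.dvd
    obtain rfl : m = j := by omega
    exact hd
  have hCle : ∀ x : G, (Subgroup.centralizer {x}).index ≤ p ^ (m + 1) := fun x =>
    hγ ▸ index_centralizer_le_card_commutator x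
  have hC : ∀ x ∉ commutator G, ¬ (Subgroup.centralizer {x}).index ≤ p ^ m := by
    intro x hx hle
    have h1 := card_classPreservingAuts_le_of_index_zpowers_sup hp (hX x hx)
    rw [hγ] at h1
    refine hbig.not_ge (h1.trans ((Nat.mul_le_mul_right _ hle).trans_eq ?_))
    ring
  have hcen : ∀ x ∉ commutator G, ¬ commutator G ≤ Subgroup.centralizer {x} := by
    intro x hx hle
    have hlt : commutator G < Subgroup.centralizer {x} :=
      lt_of_le_of_ne hle fun h => hx (h ▸ Subgroup.mem_centralizer_singleton_iff.2 rfl)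
    obtain ⟨j, hj, hd⟩ := exists_index_dvd_pow_of_lt hp hlt hγi.dvd
    obtain rfl : m = j := by omega
    exact hC x hx (Nat.le_of_dvd (pow_pos hp.pos _) hd)
  have hne : commutator G ≠ ⊤ := by
    intro h
    rw [h, Subgroup.index_top] at hγi
    exact (Nat.one_lt_pow (Nat.succ_ne_zero m) hp.one_lt).ne hγi
  obtain ⟨w, -, hw⟩ := SetLike.exists_of_lt (lt_top_iff_ne_top.2 hne)
  set N : Subgroup G := ⁅commutator G, (⊤ : Subgroup G)⁆ with hNdef
  have hNγ : N ≤ commutator G := Subgroup.commutator_le_left _ _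
  have hNbot : N ≠ ⊥ := by
    intro h
    have h1 := Subgroup.commutator_eq_bot_iff_le_centralizer.1 h
    exact hcen w hw (h1.trans (Subgroup.centralizer_le (by simp)))
  have hlt : ⁅N, (⊤ : Subgroup G)⁆ < N := lt_of_le_of_ne (Subgroup.commutator_le_left _ _)
    fun h => hNbot (eq_bot_of_commutator_top_eq_self h)
  obtain ⟨t, htm, ht⟩ := (Nat.dvd_prime_pow hp).1 (hγ ▸ Subgroup.card_dvd_of_le hNγ)
  have hti : N.relIndex (commutator G) = p ^ (m + 1 - t) := by
    have h1 := Subgroup.relIndex_mul_relIndex ⊥ N _ bot_le hNγ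
    rw [Subgroup.relIndex_bot_left, Subgroup.relIndex_bot_left, hγ, ht,
      ← Nat.add_sub_cancel' htm, pow_add] at h1
    simpa using Nat.eq_of_mul_eq_mul_left (pow_pos hp.pos _) h1
  have ht0 : t ≠ 0 := by
    rintro rfl
    exact hNbot (Subgroup.card_eq_one.1 (by simpa using ht))
  have ht1 : t ≠ 1 := by
    rintro rfl
    have hbot : ⁅N, (⊤ : Subgroup G)⁆ = ⊥ := by
      rw [pow_one] at ht
      rcases (Nat.dvd_prime hp).1 (ht ▸ Subgroup.card_dvd_of_le hlt.le) with h | h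
      · exact Subgroup.card_eq_one.1 h
      · exact absurd (Subgroup.eq_of_le_of_card_ge hlt.le (by rw [h, ht])) hlt.ne
    have hNc : N ≤ Subgroup.center G := by
      rw [← Subgroup.centralizer_univ, ← Subgroup.coe_top]
      exact Subgroup.commutator_eq_bot_iff_le_centralizer.1 hbot
    have h1 := index_centralizer_le_pow hp hNγ le_rfl hNc hti.dvd
    rw [ht, pow_one, Nat.add_sub_cancel] at h1
    have h2 : ¬ Subgroup.centralizer (commutator G : Set G) ≤ commutator G := by
      intro hle
      have := (Nat.le_of_dvd (Nat.pos_of_ne_zero Subgroup.index_ne_zero_of_finite)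
        (Subgroup.index_dvd_of_le hle)).trans h1
      rw [hγi] at this
      exact this.not_gt (Nat.pow_lt_pow_right hp.one_lt m.lt_succ_self)
    obtain ⟨x, hx, hx'⟩ := SetLike.not_le_iff_exists.1 h2
    refine hcen x hx' fun c hc => ?_
    rw [Subgroup.mem_centralizer_singleton_iff]
    exact Subgroup.mem_centralizer_iff.1 hx c hc
  have hkey : ∀ x ∉ commutator G, ∀ c ∈ commutator G, ⁅x, c⁆ ∈ ⁅N, (⊤ : Subgroup G)⁆ := by
    intro x hx
    obtain ⟨j, rfl⟩ : ∃ j, m = j + 1 := ⟨m - 1, by omega⟩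
    set D := (Subgroup.centralizer {QuotientGroup.mk' N x}).comap (QuotientGroup.mk' N) with hD
    have hDi : D.index ≤ p ^ j := by
      have h1 := index_comap_centralizer_mul_card_le hNγ x
      rw [← hD, hγ, ht] at h1
      have h2 : D.index * p ^ t ≤ p ^ j * p ^ t := by
        rw [← pow_add]
        exact h1.trans (hpp (by omega))
      exact Nat.le_of_mul_le_mul_right h2 (pow_pos hp.pos _)
    have hDX : ¬ D ≤ Subgroup.zpowers x ⊔ commutator G := by
      intro hle
      have h1 := card_classPreservingAuts_le_of_index_zpowers_sup hp
        ((Subgroup.index_dvd_of_le hle).trans (hpdvd hDi))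
      rw [hγ] at h1
      refine hbig.not_ge (h1.trans ((Nat.mul_le_mul_right _ (hCle x)).trans ?_))
      rw [← pow_mul, ← pow_add]
      exact hpp (by nlinarith)
    obtain ⟨y, hyD, hy⟩ := SetLike.not_le_iff_exists.1 hDX
    have hlt' : Subgroup.zpowers x ⊔ commutator G <
        Subgroup.zpowers x ⊔ commutator G ⊔ Subgroup.zpowers y :=
      lt_of_le_of_ne le_sup_left fun h =>
        hy (h ▸ Subgroup.mem_sup_right (Subgroup.mem_zpowers y))
    obtain ⟨l, hl, hd⟩ := exists_index_dvd_pow_of_lt hp hlt' (hX x hx)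
    obtain rfl : j = l := by omega
    have h1 := card_classPreservingAuts_le_of_commutator_mem hp
      (mem_comap_centralizer_iff.1 hyD) hd
    by_contra hcon
    have hElt : commutator G ⊓ (Subgroup.centralizer
        {QuotientGroup.mk' ⁅N, (⊤ : Subgroup G)⁆ x}).comap (QuotientGroup.mk' _) <
        commutator G := by
      refine lt_of_le_of_ne inf_le_left fun h => hcon fun c hc => ?_
      exact mem_comap_centralizer_iff.1 (inf_eq_left.1 h hc)
    set E : Subgroup G := commutator G ⊓ (Subgroup.centralizer
        {QuotientGroup.mk' ⁅N, (⊤ : Subgroup G)⁆ x}).comap (QuotientGroup.mk' _)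
    have hEc : Nat.card E ≤ p ^ (j + 1) := by
      obtain ⟨e, he, hEe⟩ := (Nat.dvd_prime_pow hp).1 (hγ ▸ Subgroup.card_dvd_of_le hElt.le)
      rw [hEe]
      refine hpp (Nat.le_of_lt_succ (lt_of_le_of_ne he ?_))
      rintro rfl
      exact hElt.ne (Subgroup.eq_of_le_of_card_ge hElt.le (by rw [hEe, hγ]))
    rw [hγ] at h1
    refine hbig.not_ge (h1.trans ((Nat.mul_le_mul (hCle x)
      (Nat.mul_le_mul_right _ hEc)).trans_eq ?_))
    ring
  refine hlt.not_ge (Subgroup.commutator_le.2 fun c hc x _ => ?_)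
  have hmem : ∀ {z}, z ∉ commutator G → ⁅c, z⁆ ∈ ⁅N, (⊤ : Subgroup G)⁆ := fun hz => by
    rw [← commutatorElement_inv]
    exact Subgroup.inv_mem _ (hkey _ hz c hc)
  by_cases hx : x ∈ commutator G
  · have hxw : x * w ∉ commutator G := fun h => hw ((Subgroup.mul_mem_cancel_left _ hx).1 h)
    rw [← mem_comap_centralizer_iff]
    have h1 := Subgroup.mul_mem _ (mem_comap_centralizer_iff.2 (hmem hxw))
      (Subgroup.inv_mem _ (mem_comap_centralizer_iff.2 (hmem hw)))
    simpa using h1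
  · exact hmem hx

end ClassPreservingBound

/-- For a non-trivial finite `p`-group `G` of order `pⁿ`,
`|Aut_c(G)| ≤ p^{(n²-4)/4}` if `n` is even and `|Aut_c(G)| ≤ p^{(n²-1)/4}`
if `n` is odd. -/
theorem autc_card_upper_bound
    {p : ℕ} (hp : p.Prime) {G : Type*} [Group G] [Finite G] [Nontrivial G]
    {n : ℕ} (hcard : Nat.card G = p ^ n) :
    (Even n → Nat.card (classPreservingAuts G) ≤ p ^ ((n ^ 2 - 4) / 4)) ∧
    (Odd n → Nat.card (classPreservingAuts G) ≤ p ^ ((n ^ 2 - 1) / 4)) := by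
  have : Fact p.Prime := ⟨hp⟩
  have : Group.IsNilpotent G := (IsPGroup.of_card hcard).isNilpotent
  obtain ⟨b, hbn, hb⟩ := (Nat.dvd_prime_pow hp).1 (hcard ▸ (commutator G).card_subgroup_dvd_card)
  obtain ⟨a, rfl⟩ := Nat.exists_eq_add_of_le hbn
  have hidx : (commutator G).index = p ^ a := by
    have := (commutator G).card_mul_index
    rw [hb, hcard, pow_add] at this
    exact Nat.eq_of_mul_eq_mul_left (pow_pos hp.pos _) this
  have hmain : Nat.card (classPreservingAuts G) ≤ p ^ (b * a) := by
    have h := card_le_pow_of_le_classPreservingAuts (G := G) hp (H := ⊥) le_rfl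
      (fun α _ h hh => by rw [Subgroup.mem_bot.1 hh, map_one])
      (k := a) (by rw [bot_sup_eq, hidx])
    rwa [hb, ← pow_mul] at h
  constructor
  · rintro ⟨m, hm⟩
    have hm0 : m ≠ 0 := by
      rintro rfl
      rw [hm] at hcard
      exact Finite.one_lt_card.ne' (hcard.trans (pow_zero p))
    obtain ⟨m, rfl⟩ := Nat.exists_eq_succ_of_ne_zero hm0
    have hexp : ((b + a) ^ 2 - 4) / 4 = m * m + 2 * m := by
      have : (b + a) ^ 2 = 4 * (m * m + 2 * m) + 4 := by rw [hm, Nat.succ_eq_add_one]; ring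
      omega
    rw [hexp]
    by_cases hab : b = m + 1
    · exact card_classPreservingAuts_le_of_card_commutator hp
        (by rw [hcard, hm, two_mul]) (by rw [hb, hab])
    · refine hmain.trans (Nat.pow_le_pow_right hp.pos ?_)
      rcases lt_or_gt_of_ne hab with h | h
      · obtain ⟨c, rfl⟩ : ∃ c, m = b + c := ⟨m - b, by omega⟩
        obtain rfl : a = b + 2 * c + 2 := by omega
        nlinarith
      · obtain ⟨c, rfl⟩ : ∃ c, m = a + c := ⟨m - a, by omega⟩
        obtain rfl : b = a + 2 * c + 2 := by omega
        nlinarith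
  · rintro ⟨m, hm⟩
    refine hmain.trans (Nat.pow_le_pow_right hp.pos ?_)
    have hexp : ((b + a) ^ 2 - 1) / 4 = m * m + m := by
      have : (b + a) ^ 2 = 4 * (m * m + m) + 1 := by rw [hm]; ring
      omega
    rw [hexp]
    rcases le_or_gt b m with h | h
    · obtain ⟨c, rfl⟩ := Nat.exists_eq_add_of_le h
      obtain rfl : a = b + 2 * c + 1 := by omega
      nlinarith
    · obtain ⟨c, rfl⟩ : ∃ c, m = a + c := ⟨m - a, by omega⟩
      obtain rfl : b = a + 2 * c + 1 := by omega
      nlinarith
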